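/- arXiv:1803.11271 — 3 statements merged into one kernel-verified Lean document; each statement's English description precedes it below -/
import Mathlib

section
/- Let m > n ≥ 1 be integers and a > 0. Define G : ℝ^m → {0,1} by G(ω) = 1 if ((ω_1² + ⋯ + ω_n²)/n) / ((ω_{n+1}² + ⋯ + ω_m²)/(m−n)) > a and G(ω) = 0 otherwise, and let γ_m be the standard Gaussian measure on ℝ^m. Set c_4(a,n,m) = (na/(m−n))^{n/2} Γ(m/2) / ((1 + na/(m−n))^{m/2} Γ((m−n)/2) Γ(n/2)). Then for every 1 ≤ j ≤ n, ∫_{ℝ^m} G(ω)·(ω_j² − 1) dγ_m(ω) = 2 c_4(a,n,m)/n, and for every n+1 ≤ j ≤ m, ∫_{ℝ^m} G(ω)·(ω_j² − 1) dγ_m(ω) = −2 c_4(a,n,m)/(m−n). In particular G has Hermite rank 2. -/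
open MeasureTheory ProbabilityTheory Finset

/-- Probabilists' Hermite polynomials: `He₀ = 1`, `He₁(x) = x`,
`He_{n+1}(x) = x·He_n(x) − n·He_{n−1}(x)`. -/
noncomputable def He : ℕ → ℝ → ℝ
  | 0, _ => 1
  | 1, x => x
  | n + 2, x => x * He (n + 1) x - ((n : ℝ) + 1) * He n x

/-- `γ_m`: the standard Gaussian measure on `ℝ^m`. -/
noncomputable def stdGaussian (m : ℕ) : Measure (Fin m → ℝ) :=
  Measure.pi fun _ => gaussianReal 0 1

/-- `G(ω) = 1` if `((ω₁²+⋯+ω_n²)/n)/((ω_{n+1}²+⋯+ω_m²)/(m−n)) > a`, else `0`. -/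
noncomputable def Gfun (m n : ℕ) (a : ℝ) (ω : Fin m → ℝ) : ℝ :=
  if ((∑ i ∈ Finset.univ.filter (fun i : Fin m => (i : ℕ) < n), ω i ^ 2) / (n : ℝ)) /
       ((∑ i ∈ Finset.univ.filter (fun i : Fin m => n ≤ (i : ℕ)), ω i ^ 2) /
         ((m : ℝ) - (n : ℝ))) > a
  then 1 else 0

/-- `c₄(a,n,m) = (na/(m−n))^{n/2} Γ(m/2) / ((1 + na/(m−n))^{m/2} Γ((m−n)/2) Γ(n/2))`. -/
noncomputable def c4 (a : ℝ) (n m : ℕ) : ℝ :=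
  (((n : ℝ) * a / ((m : ℝ) - (n : ℝ))) ^ ((n : ℝ) / 2) * Real.Gamma ((m : ℝ) / 2)) /
    ((1 + (n : ℝ) * a / ((m : ℝ) - (n : ℝ))) ^ ((m : ℝ) / 2) *
      Real.Gamma (((m : ℝ) - (n : ℝ)) / 2) * Real.Gamma ((n : ℝ) / 2))


lemma pi_gauss_eq (ι : Type*) [Fintype ι] :
    (Measure.pi fun _ : ι => gaussianReal 0 1) =
      (volume : Measure (ι → ℝ)).withDensity
        (fun ω => ENNReal.ofReal (∏ i, gaussianPDFReal 0 1 (ω i))) := by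
  refine Measure.pi_eq fun s hs => ?_
  rw [withDensity_apply _ (MeasurableSet.univ_pi hs), volume_pi, Measure.restrict_pi_pi,
    ← ofReal_integral_eq_lintegral_ofReal]
  · rw [integral_fintype_prod_eq_prod (f := fun (i : ι) (x : ℝ) => gaussianPDFReal 0 1 x),
      ENNReal.ofReal_prod_of_nonneg]
    · refine Finset.prod_congr rfl fun i _ => ?_
      rw [gaussianReal_apply_eq_integral _ one_ne_zero]
    · intro i _
      exact integral_nonneg fun x => gaussianPDFReal_nonneg _ _ _
  · exact Integrable.fintype_prod (f := fun (i : ι) (x : ℝ) => gaussianPDFReal 0 1 x)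
      fun i => (integrable_gaussianPDFReal 0 1).restrict
  · exact Filter.Eventually.of_forall fun ω =>
      Finset.prod_nonneg fun i _ => gaussianPDFReal_nonneg _ _ _

lemma integral_pi_gauss (ι : Type*) [Fintype ι] (f : (ι → ℝ) → ℝ) :
    ∫ ω, f ω ∂(Measure.pi fun _ : ι => gaussianReal 0 1) =
      ∫ ω : ι → ℝ, (∏ i, gaussianPDFReal 0 1 (ω i)) * f ω := by
  rw [pi_gauss_eq, integral_withDensity_eq_integral_toReal_smul]
  · refine integral_congr_ae (Filter.Eventually.of_forall fun ω => ?_)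
    simp only [smul_eq_mul]
    rw [ENNReal.toReal_ofReal (Finset.prod_nonneg fun i _ => gaussianPDFReal_nonneg _ _ _)]
  · refine Measurable.ennreal_ofReal ?_
    refine Finset.measurable_prod _ fun i _ => ?_
    exact (measurable_gaussianPDFReal 0 1).comp (measurable_pi_apply i)
  · exact Filter.Eventually.of_forall fun ω => ENNReal.ofReal_lt_top

noncomputable def Cst (k : ℕ) : ℝ := 2 / (Real.Gamma ((k : ℝ) / 2) * √2 ^ k)

lemma prod_pdf {ι : Type*} [Fintype ι] (ω : ι → ℝ) :
    ∏ i, gaussianPDFReal 0 1 (ω i) =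
      (√(2 * Real.pi))⁻¹ ^ Fintype.card ι * Real.exp (-(∑ i, ω i ^ 2) / 2) := by
  simp only [gaussianPDFReal, Finset.prod_mul_distrib, ← Real.exp_sum]
  simp [neg_div, Finset.sum_div]

lemma polar (ι : Type*) [Fintype ι] [Nonempty ι] (g : ℝ → ℝ) :
    ∫ ω, g (∑ i, ω i ^ 2) ∂(Measure.pi fun _ : ι => gaussianReal 0 1) =
      Cst (Fintype.card ι) * ∫ r in Set.Ioi (0 : ℝ),
        r ^ (Fintype.card ι - 1) * Real.exp (-r ^ 2 / 2) * g (r ^ 2) := by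
  have hk : (0 : ℝ) < Fintype.card ι := by exact_mod_cast Fintype.card_pos
  rw [integral_pi_gauss]
  simp only [prod_pdf]
  set k := Fintype.card ι with hkd
  have h1 := (PiLp.volume_preserving_ofLp ι).integral_comp
    (MeasurableEquiv.toLp 2 (ι → ℝ)).symm.measurableEmbedding
    (fun ω : ι → ℝ => (√(2 * Real.pi))⁻¹ ^ k * Real.exp (-(∑ i, ω i ^ 2) / 2) * g (∑ i, ω i ^ 2))
  rw [← h1]
  have h2 := integral_fun_norm_addHaar (volume : Measure (EuclideanSpace ℝ ι))
    (fun r => (√(2 * Real.pi))⁻¹ ^ k * Real.exp (-r ^ 2 / 2) * g (r ^ 2))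
  simp only [EuclideanSpace.real_norm_sq_eq] at h2
  rw [h2, Measure.real, EuclideanSpace.volume_ball, finrank_euclideanSpace, ← hkd]
  simp only [ENNReal.ofReal_one, one_pow, one_mul, nsmul_eq_mul, smul_eq_mul]
  have hG : 0 < Real.Gamma ((k : ℝ) / 2) := Real.Gamma_pos_of_pos (by positivity)
  rw [Real.Gamma_add_one (by positivity), ENNReal.toReal_ofReal (by positivity)]
  have : (∫ r in Set.Ioi (0 : ℝ), r ^ (k - 1) * ((√(2 * Real.pi))⁻¹ ^ k * Real.exp (-r ^ 2 / 2) * g (r ^ 2)))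
     = (√(2 * Real.pi))⁻¹ ^ k * ∫ r in Set.Ioi (0 : ℝ),
        r ^ (k - 1) * Real.exp (-r ^ 2 / 2) * g (r ^ 2) := by
    rw [← integral_const_mul]
    congr 1; ext r; ring
  rw [this, Cst, Real.sqrt_mul (by norm_num), inv_pow, mul_pow]
  have hp : 0 < √Real.pi := Real.sqrt_pos.2 Real.pi_pos
  have h2 : 0 < √(2:ℝ) := by positivity
  field_simp

lemma gauss_moment (k : ℕ) (hk : 1 ≤ k) (c : ℝ) (hc : 0 < c) :
    ∫ r in Set.Ioi (0 : ℝ), r ^ (k - 1) * Real.exp (-(c * r ^ 2) / 2) =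
      c ^ (-(k : ℝ) / 2) * √2 ^ k / 2 * Real.Gamma ((k : ℝ) / 2) := by
  have h := integral_rpow_mul_exp_neg_mul_rpow (p := 2) (q := (k : ℝ) - 1) (b := c / 2)
    (by norm_num) (by have : (1:ℝ) ≤ k := by exact_mod_cast hk
                      linarith) (by positivity)
  have e : ∀ r : ℝ, r ^ ((k : ℝ) - 1) * Real.exp (-(c / 2) * r ^ (2 : ℝ)) =
      r ^ (k - 1) * Real.exp (-(c * r ^ 2) / 2) := by
    intro r
    have : ((k : ℝ) - 1) = ((k - 1 : ℕ) : ℝ) := by push_cast [hk]; ring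
    rw [this, Real.rpow_natCast, Real.rpow_two]; ring_nf
  simp only [e] at h
  rw [h, sub_add_cancel, Real.div_rpow hc.le (by norm_num)]
  have : (2 : ℝ) ^ (-(k : ℝ) / 2) = (√2 ^ k)⁻¹ := by
    rw [neg_div, Real.rpow_neg (by norm_num), Real.sqrt_eq_rpow, ← Real.rpow_natCast, ← Real.rpow_mul (by norm_num)]
    ring_nf
  rw [this]
  field_simp

lemma hasDeriv_aux (k : ℕ) (hk : 1 ≤ k) (r : ℝ) :
    HasDerivAt (fun r : ℝ => -(r ^ k * Real.exp (-r ^ 2 / 2)))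
      (r ^ (k - 1) * Real.exp (-r ^ 2 / 2) * (r ^ 2 - k)) r := by
  have h1 : HasDerivAt (fun r : ℝ => -r ^ 2 / 2) (-r) r := by
    refine (((hasDerivAt_pow 2 r).neg).div_const 2).congr_deriv ?_
    norm_num
    ring
  refine ((hasDerivAt_pow k r).mul h1.exp).neg.congr_deriv ?_
  obtain ⟨l, rfl⟩ : ∃ l, k = l + 1 := ⟨k - 1, by omega⟩
  simp; ring

lemma intOn (k : ℕ) : IntegrableOn (fun r : ℝ => r ^ k * Real.exp (-r ^ 2 / 2)) (Set.Ioi 0) := by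
  have := integrableOn_rpow_mul_exp_neg_mul_sq (b := 1/2) (by norm_num) (s := k) (by
    have : (0:ℝ) ≤ k := by positivity
    linarith)
  refine this.congr_fun (fun r _ => ?_) measurableSet_Ioi
  simp only [Real.rpow_natCast]; ring_nf

lemma tail_int (k : ℕ) (hk : 1 ≤ k) (s : ℝ) (hs : 0 ≤ s) :
    ∫ r in Set.Ioi s, r ^ (k - 1) * Real.exp (-r ^ 2 / 2) * (r ^ 2 - k) =
      s ^ k * Real.exp (-s ^ 2 / 2) := by
  rw [integral_Ioi_of_hasDerivAt_of_tendsto' (m := 0) (fun x _ => hasDeriv_aux k hk x)]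
  · ring
  · have h1 := (intOn (k - 1 + 2)).sub ((intOn (k - 1)).const_mul (k : ℝ))
    refine (h1.mono_set (Set.Ioi_subset_Ioi hs)).congr_fun (fun r _ => ?_) measurableSet_Ioi
    simp only [Pi.sub_apply]; ring
  · have h := rpow_mul_exp_neg_mul_sq_isLittleO_exp_neg (b := 1/2) (by norm_num) (k : ℝ)
    have h2 : Filter.Tendsto (fun x : ℝ => Real.exp (-(1/2) * x)) Filter.atTop (nhds 0) := by
      refine Real.tendsto_exp_atBot.comp ?_
      exact Filter.tendsto_id.const_mul_atTop_of_neg (by norm_num)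
    have h3 := (h.trans_tendsto h2).neg
    rw [neg_zero] at h3
    refine h3.congr fun r => ?_
    simp only [Real.rpow_natCast]; ring_nf

lemma head_int (k : ℕ) (hk : 1 ≤ k) (s : ℝ) (hs : 0 ≤ s) :
    ∫ r in Set.Ioo 0 s, r ^ (k - 1) * Real.exp (-r ^ 2 / 2) * (r ^ 2 - k) =
      -(s ^ k * Real.exp (-s ^ 2 / 2)) := by
  rw [← integral_Ioc_eq_integral_Ioo, ← intervalIntegral.integral_of_le hs,
    intervalIntegral.integral_eq_sub_of_hasDerivAt (fun x _ => hasDeriv_aux k hk x)]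
  · simp [show k ≠ 0 by omega]
  · apply Continuous.intervalIntegrable
    fun_prop

lemma sq_int {ι : Type*} [Fintype ι] (j : ι) :
    Integrable (fun ω : ι → ℝ => ω j ^ 2 - 1) (Measure.pi fun _ : ι => gaussianReal 0 1) := by
  have h : Integrable (fun x : ℝ => x ^ 2 - 1) (gaussianReal 0 1) :=
    ((memLp_id_gaussianReal (μ := 0) (v := 1) 2).integrable_sq).sub (integrable_const 1)
  exact (measurePreserving_eval (fun _ : ι => gaussianReal 0 1) j).integrable_comp_of_integrable h

lemma symm_red {ι : Type*} [Fintype ι] (g : ℝ → ℝ) (hg : Measurable g) (hb : ∀ x, ‖g x‖ ≤ 1)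
    (j : ι) :
    ∫ ω, g (∑ i, ω i ^ 2) * (ω j ^ 2 - 1) ∂(Measure.pi fun _ : ι => gaussianReal 0 1) =
      (∫ ω, g (∑ i, ω i ^ 2) * (∑ i, ω i ^ 2 - Fintype.card ι)
        ∂(Measure.pi fun _ : ι => gaussianReal 0 1)) / Fintype.card ι := by
  classical
  have : Nonempty ι := ⟨j⟩
  have hk : (0 : ℝ) < Fintype.card ι := by exact_mod_cast Fintype.card_pos
  have hint : ∀ i, Integrable (fun ω : ι → ℝ => g (∑ i, ω i ^ 2) * (ω i ^ 2 - 1))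
      (Measure.pi fun _ : ι => gaussianReal 0 1) := fun i =>
    (sq_int i).bdd_mul (c := 1)
      (hg.comp (by fun_prop : Measurable fun ω : ι → ℝ => ∑ i, ω i ^ 2)).aestronglyMeasurable
      (Filter.Eventually.of_forall fun ω => hb _)
  have hs : ∀ i,
      ∫ ω, g (∑ i, ω i ^ 2) * (ω i ^ 2 - 1) ∂(Measure.pi fun _ : ι => gaussianReal 0 1) =
      ∫ ω, g (∑ i, ω i ^ 2) * (ω j ^ 2 - 1) ∂(Measure.pi fun _ : ι => gaussianReal 0 1) := by
    intro i
    have mp := measurePreserving_arrowCongr' (fun _ : ι => gaussianReal 0 1)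
      (fun _ : ι => gaussianReal 0 1) (Equiv.swap i j) (MeasurableEquiv.refl ℝ)
      (fun _ => MeasurePreserving.id _)
    have := mp.integral_comp (MeasurableEquiv.measurableEmbedding _)
      (fun ω : ι → ℝ => g (∑ i, ω i ^ 2) * (ω i ^ 2 - 1))
    rw [← this]
    refine integral_congr_ae (Filter.Eventually.of_forall fun ω => ?_)
    have e : ∀ x, (MeasurableEquiv.arrowCongr' (Equiv.swap i j) (MeasurableEquiv.refl ℝ)) ω x
        = ω (Equiv.swap i j x) := by
      intro x
      rfl
    simp only [e]
    rw [Equiv.sum_comp (Equiv.swap i j) (fun x => ω x ^ 2), Equiv.swap_apply_left]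
  rw [eq_div_iff hk.ne']
  have : ∀ ω : ι → ℝ, g (∑ i, ω i ^ 2) * (∑ i, ω i ^ 2 - Fintype.card ι) =
      ∑ i, g (∑ i, ω i ^ 2) * (ω i ^ 2 - 1) := by
    intro ω
    rw [← Finset.mul_sum, Finset.sum_sub_distrib]
    simp
  simp only [this]
  rw [integral_finsetSum _ (fun i _ => hint i), Finset.sum_congr rfl (fun i _ => hs i)]
  simp [mul_comm]

lemma inner_tail {ι : Type*} [Fintype ι] (g : ℝ → ℝ) (hg : Measurable g) (hb : ∀ x, ‖g x‖ ≤ 1)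
    (j : ι) (s : ℝ) (hs : 0 ≤ s) (hgs : ∀ r, 0 < r → g (r ^ 2) = if s < r then 1 else 0) :
    ∫ ω, g (∑ i, ω i ^ 2) * (ω j ^ 2 - 1) ∂(Measure.pi fun _ : ι => gaussianReal 0 1) =
      1 * (Cst (Fintype.card ι) * (s ^ (Fintype.card ι) * Real.exp (-s ^ 2 / 2))
        / Fintype.card ι) := by
  have : Nonempty ι := ⟨j⟩
  rw [symm_red g hg hb, polar ι (fun y => g y * (y - Fintype.card ι)), one_mul,
    ← tail_int _ Fintype.card_pos s hs]
  congr 2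
  rw [← integral_indicator measurableSet_Ioi, ← integral_indicator measurableSet_Ioi]
  congr 1; ext r
  by_cases h0 : 0 < r
  · by_cases h1 : s < r <;> simp [Set.indicator, h0, h1, hgs r h0]
  · have : ¬ s < r := by linarith
    simp [Set.indicator, h0, this]

lemma inner_head {ι : Type*} [Fintype ι] (g : ℝ → ℝ) (hg : Measurable g) (hb : ∀ x, ‖g x‖ ≤ 1)
    (j : ι) (s : ℝ) (hs : 0 ≤ s) (hgs : ∀ r, 0 < r → g (r ^ 2) = if r < s then 1 else 0) :
    ∫ ω, g (∑ i, ω i ^ 2) * (ω j ^ 2 - 1) ∂(Measure.pi fun _ : ι => gaussianReal 0 1) =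
      (-1) * (Cst (Fintype.card ι) * (s ^ (Fintype.card ι) * Real.exp (-s ^ 2 / 2))
        / Fintype.card ι) := by
  have : Nonempty ι := ⟨j⟩
  rw [symm_red g hg hb, polar ι (fun y => g y * (y - Fintype.card ι)), neg_one_mul, ← neg_div,
    ← mul_neg, ← head_int _ Fintype.card_pos s hs]
  congr 2
  rw [← integral_indicator measurableSet_Ioi, ← integral_indicator measurableSet_Ioo]
  congr 1; ext r
  by_cases h0 : 0 < r
  · by_cases h1 : r < s <;> simp [Set.indicator, h0, h1, hgs r h0]
  · simp [Set.indicator, h0]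

lemma core {ι κ : Type*} [Fintype ι] [Fintype κ] [Nonempty κ] (F : ℝ → ℝ → ℝ) (j : ι)
    (ε t : ℝ) (ht : 0 ≤ t)
    (hin : ∀ ρ, 0 < ρ → ∫ ω, F (∑ i, ω i ^ 2) (ρ ^ 2) * (ω j ^ 2 - 1)
        ∂(Measure.pi fun _ : ι => gaussianReal 0 1) =
        ε * (Cst (Fintype.card ι) * ((t * ρ) ^ (Fintype.card ι) * Real.exp (-(t * ρ) ^ 2 / 2))
          / Fintype.card ι)) :
    ∫ y, ∫ x, F (∑ i, x i ^ 2) (∑ i, y i ^ 2) * (x j ^ 2 - 1)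
        ∂(Measure.pi fun _ : ι => gaussianReal 0 1) ∂(Measure.pi fun _ : κ => gaussianReal 0 1) =
      ε * (2 * (t ^ Fintype.card ι *
        (1 + t ^ 2) ^ (-((Fintype.card ι + Fintype.card κ : ℕ) : ℝ) / 2) *
        Real.Gamma (((Fintype.card ι + Fintype.card κ : ℕ) : ℝ) / 2) /
        (Real.Gamma ((Fintype.card ι : ℝ) / 2) * Real.Gamma ((Fintype.card κ : ℝ) / 2)))
          / Fintype.card ι) := by
  have : Nonempty ι := ⟨j⟩
  have hk : (0 : ℝ) < Fintype.card ι := by exact_mod_cast Fintype.card_pos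
  have hl' : 1 ≤ Fintype.card κ := Fintype.card_pos
  have hl : (0 : ℝ) < Fintype.card κ := by exact_mod_cast Fintype.card_pos
  rw [polar κ (fun Y => ∫ x, F (∑ i, x i ^ 2) Y * (x j ^ 2 - 1)
        ∂(Measure.pi fun _ : ι => gaussianReal 0 1))]
  set k := Fintype.card ι
  set l := Fintype.card κ
  have : ∫ r in Set.Ioi (0 : ℝ), r ^ (l - 1) * Real.exp (-r ^ 2 / 2) *
      (∫ x, F (∑ i, x i ^ 2) (r ^ 2) * (x j ^ 2 - 1)
        ∂(Measure.pi fun _ : ι => gaussianReal 0 1)) =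
      (ε * Cst k * t ^ k / k) * ∫ r in Set.Ioi (0 : ℝ), r ^ (k + l - 1) *
        Real.exp (-((1 + t ^ 2) * r ^ 2) / 2) := by
    rw [← integral_const_mul]
    refine setIntegral_congr_fun measurableSet_Ioi fun r hr => ?_
    rw [hin r hr, show -((1 + t ^ 2) * r ^ 2) / 2 = -r ^ 2 / 2 + -(t * r) ^ 2 / 2 by ring,
      Real.exp_add, show k + l - 1 = (l - 1) + k by omega, pow_add, mul_pow]
    ring
  rw [this, gauss_moment _ (by omega) _ (by positivity)]
  have hG1 : 0 < Real.Gamma ((k : ℝ) / 2) := Real.Gamma_pos_of_pos (by positivity)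
  have hG2 : 0 < Real.Gamma ((l : ℝ) / 2) := Real.Gamma_pos_of_pos (by positivity)
  have h2 : 0 < √(2 : ℝ) := by positivity
  unfold Cst
  rw [pow_add]
  generalize (1 + t ^ 2) ^ (-((k + l : ℕ) : ℝ) / 2) = A
  generalize Real.Gamma (((k + l : ℕ) : ℝ) / 2) = B
  field_simp

lemma card_lt (m n : ℕ) (hnm : n < m) : Fintype.card {i : Fin m // (i : ℕ) < n} = n := by
  rw [Fintype.card_subtype, Fin.card_filter_val_lt]; omega

lemma card_ge (m n : ℕ) (hnm : n < m) : Fintype.card {i : Fin m // ¬ (i : ℕ) < n} = m - n := by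
  rw [Fintype.card_subtype_compl, card_lt m n hnm, Fintype.card_fin]

/-- `Gfun` as a function of the two sums of squares. -/
noncomputable def Hfun (m n : ℕ) (a X Y : ℝ) : ℝ :=
  if (X / (n : ℝ)) / (Y / ((m : ℝ) - (n : ℝ))) > a then 1 else 0

lemma Hfun_meas (m n : ℕ) (a : ℝ) : Measurable (fun p : ℝ × ℝ => Hfun m n a p.1 p.2) := by
  unfold Hfun
  refine Measurable.ite ?_ measurable_const measurable_const
  exact measurableSet_lt measurable_const (by fun_prop)

lemma Hfun_le (m n : ℕ) (a X Y : ℝ) : ‖Hfun m n a X Y‖ ≤ 1 := by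
  unfold Hfun; split_ifs <;> simp

lemma Hfun_sq (m n : ℕ) (hn : 1 ≤ n) (hnm : n < m) (a : ℝ) (ha : 0 < a) (t : ℝ) (ht : 0 < t)
    (htb : t ^ 2 = n * a / ((m : ℝ) - n)) (r ρ : ℝ) (hr : 0 < r) (hρ : 0 < ρ) :
    Hfun m n a (r ^ 2) (ρ ^ 2) = if t * ρ < r then 1 else 0 := by
  have hn' : (0 : ℝ) < n := by exact_mod_cast hn
  have hd : (0 : ℝ) < (m : ℝ) - n := by
    have : (n : ℝ) < m := by exact_mod_cast hnm
    linarith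
  unfold Hfun
  congr 1
  rw [eq_iff_iff, ← pow_lt_pow_iff_left₀ (by positivity) hr.le (two_ne_zero), mul_pow, htb, gt_iff_lt,
    lt_div_iff₀ (by positivity), lt_div_iff₀ hn']
  have : a * (ρ ^ 2 / (↑m - ↑n)) * ↑n = ↑n * a / (↑m - ↑n) * ρ ^ 2 := by ring
  rw [this]

lemma Gfun_eq (m n : ℕ) (a : ℝ) (ω : Fin m → ℝ) :
    Gfun m n a ω = Hfun m n a (∑ i : {i : Fin m // (i : ℕ) < n}, ω i ^ 2)
      (∑ i : {i : Fin m // ¬ (i : ℕ) < n}, ω i ^ 2) := by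
  unfold Gfun Hfun
  rw [Finset.sum_subtype (p := fun i : Fin m => (i : ℕ) < n) _ (by simp),
    Finset.sum_subtype (p := fun i : Fin m => ¬ (i : ℕ) < n) _ (by simp)]

lemma Gfun_int {m n : ℕ} (a : ℝ) (f : ({i : Fin m // (i : ℕ) < n} → ℝ) ×
    ({i : Fin m // ¬ (i : ℕ) < n} → ℝ) → ℝ) :
    ∫ ω, Gfun m n a ω * f (fun i => ω i, fun i => ω i)
      ∂(Measure.pi fun _ : Fin m => gaussianReal 0 1) =
    ∫ z, Hfun m n a (∑ i, z.1 i ^ 2) (∑ i, z.2 i ^ 2) * f z ∂((Measure.pi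
      fun _ : {i : Fin m // (i : ℕ) < n} => gaussianReal 0 1).prod
      (Measure.pi fun _ : {i : Fin m // ¬ (i : ℕ) < n} => gaussianReal 0 1)) := by
  have mp := measurePreserving_piEquivPiSubtypeProd (fun _ : Fin m => gaussianReal 0 1)
    (fun i : Fin m => (i : ℕ) < n)
  rw [← mp.integral_comp (MeasurableEquiv.measurableEmbedding _)]
  refine integral_congr_ae (Filter.Eventually.of_forall fun ω => ?_)
  simp only [Gfun_eq]
  rfl

lemma H_integrable {ι κ : Type*} [Fintype ι] [Fintype κ] (m n : ℕ) (a : ℝ)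
    (f : (ι → ℝ) × (κ → ℝ) → ℝ)
    (hf : Integrable f ((Measure.pi fun _ : ι => gaussianReal 0 1).prod
      (Measure.pi fun _ : κ => gaussianReal 0 1))) :
    Integrable (fun z => Hfun m n a (∑ i, z.1 i ^ 2) (∑ i, z.2 i ^ 2) * f z)
      ((Measure.pi fun _ : ι => gaussianReal 0 1).prod
      (Measure.pi fun _ : κ => gaussianReal 0 1)) := by
  refine hf.bdd_mul (c := 1) ?_ (Filter.Eventually.of_forall fun ω => Hfun_le _ _ _ _ _)
  refine Measurable.aestronglyMeasurable ?_
  exact (Hfun_meas m n a).comp (by fun_prop :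
    Measurable fun z : (ι → ℝ) × (κ → ℝ) => (∑ i, z.1 i ^ 2, ∑ i, z.2 i ^ 2))

lemma c4_eq1 (m n : ℕ) (hn : 1 ≤ n) (hnm : n < m) (a : ℝ) (ha : 0 < a) (t : ℝ) (ht : 0 < t)
    (htb : t ^ 2 = n * a / ((m : ℝ) - n)) :
    t ^ n * (1 + t ^ 2) ^ (-((n + (m - n) : ℕ) : ℝ) / 2) *
        Real.Gamma (((n + (m - n) : ℕ) : ℝ) / 2) /
        (Real.Gamma ((n : ℝ) / 2) * Real.Gamma (((m - n : ℕ) : ℝ) / 2)) = c4 a n m := by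
  unfold c4
  rw [← htb, show n + (m - n) = m by omega, Nat.cast_sub hnm.le, neg_div,
    Real.rpow_neg (by positivity), ← Real.rpow_natCast t 2, ← Real.rpow_mul ht.le,
    show ((2 : ℕ) : ℝ) * ((n : ℝ) / 2) = n by push_cast; ring, Real.rpow_natCast,
    Real.rpow_natCast]
  simp only [div_eq_mul_inv, mul_inv]
  ring

lemma c4_eq2 (m n : ℕ) (hn : 1 ≤ n) (hnm : n < m) (a : ℝ) (ha : 0 < a) (t : ℝ) (ht : 0 < t)
    (htb : t ^ 2 = n * a / ((m : ℝ) - n)) :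
    t⁻¹ ^ (m - n) * (1 + t⁻¹ ^ 2) ^ (-(((m - n) + n : ℕ) : ℝ) / 2) *
        Real.Gamma ((((m - n) + n : ℕ) : ℝ) / 2) /
        (Real.Gamma (((m - n : ℕ) : ℝ) / 2) * Real.Gamma ((n : ℝ) / 2)) = c4 a n m := by
  rw [← c4_eq1 m n hn hnm a ha t ht htb, add_comm (m - n) n, mul_comm (Real.Gamma ((n : ℝ) / 2))]
  congr 2
  rw [show n + (m - n) = m by omega]
  have h1 : 1 + t⁻¹ ^ 2 = (1 + t ^ 2) / t ^ 2 := by field_simp; ring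
  have h2 : (t ^ 2) ^ (-(m : ℝ) / 2) = (t ^ m)⁻¹ := by
    rw [neg_div, Real.rpow_neg (by positivity), ← Real.rpow_natCast t 2, ← Real.rpow_mul ht.le,
    show ((2 : ℕ) : ℝ) * ((m : ℝ) / 2) = m by push_cast; ring, Real.rpow_natCast]
  rw [h1, Real.div_rpow (by positivity) (by positivity), h2]
  have h3 : t ^ m = t ^ n * t ^ (m - n) := by rw [← pow_add]; congr 1; omega
  rw [h3, inv_pow]
  field_simp

lemma part1 (m n : ℕ) (hn : 1 ≤ n) (hnm : n < m) (a : ℝ) (ha : 0 < a) (j : Fin m)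
    (hj : (j : ℕ) < n) :
    ∫ ω, Gfun m n a ω * (ω j ^ 2 - 1) ∂(Measure.pi fun _ : Fin m => gaussianReal 0 1)
      = 2 * c4 a n m / (n : ℝ) := by
  have hn' : (0 : ℝ) < n := by exact_mod_cast hn
  have hd : (0 : ℝ) < (m : ℝ) - n := by
    have : (n : ℝ) < m := by exact_mod_cast hnm
    linarith
  have hb : 0 < n * a / ((m : ℝ) - n) := by positivity
  have htb := Real.sq_sqrt hb.le
  have ht := Real.sqrt_pos.2 hb
  set t := √(n * a / ((m : ℝ) - n))
  have : Nonempty {i : Fin m // ¬ (i : ℕ) < n} := ⟨⟨⟨n, hnm⟩, by simp⟩⟩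
  rw [Gfun_int a (fun z => z.1 ⟨j, hj⟩ ^ 2 - 1), integral_prod_symm _ (H_integrable m n a _
    ((sq_int _).comp_fst _))]
  have h := core (ι := {i : Fin m // (i : ℕ) < n}) (κ := {i : Fin m // ¬ (i : ℕ) < n})
    (Hfun m n a) ⟨j, hj⟩ 1 t ht.le ?_
  · rw [card_lt m n hnm, card_ge m n hnm, c4_eq1 m n hn hnm a ha t ht htb, one_mul] at h
    exact h
  · intro ρ hρ
    refine inner_tail (fun x => Hfun m n a x (ρ ^ 2))
      ((Hfun_meas m n a).comp (by fun_prop : Measurable fun x : ℝ => (x, ρ ^ 2)))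
      (fun x => Hfun_le _ _ _ _ _) _ _ (by positivity) fun r hr => ?_
    exact Hfun_sq m n hn hnm a ha t ht htb r ρ hr hρ

lemma part2 (m n : ℕ) (hn : 1 ≤ n) (hnm : n < m) (a : ℝ) (ha : 0 < a) (j : Fin m)
    (hj : n ≤ (j : ℕ)) :
    ∫ ω, Gfun m n a ω * (ω j ^ 2 - 1) ∂(Measure.pi fun _ : Fin m => gaussianReal 0 1)
      = -(2 * c4 a n m / ((m : ℝ) - (n : ℝ))) := by
  have hn' : (0 : ℝ) < n := by exact_mod_cast hn
  have hd : (0 : ℝ) < (m : ℝ) - n := by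
    have : (n : ℝ) < m := by exact_mod_cast hnm
    linarith
  have hb : 0 < n * a / ((m : ℝ) - n) := by positivity
  have htb := Real.sq_sqrt hb.le
  have ht := Real.sqrt_pos.2 hb
  set t := √(n * a / ((m : ℝ) - n))
  have : Nonempty {i : Fin m // (i : ℕ) < n} := ⟨⟨⟨0, by omega⟩, hn⟩⟩
  rw [Gfun_int a (fun z => z.2 ⟨j, not_lt.2 hj⟩ ^ 2 - 1), integral_prod _ (H_integrable m n a _
    ((sq_int _).comp_snd _))]
  have h := core (ι := {i : Fin m // ¬ (i : ℕ) < n}) (κ := {i : Fin m // (i : ℕ) < n})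
    (fun Y X => Hfun m n a X Y) ⟨j, not_lt.2 hj⟩ (-1) t⁻¹ (by positivity) ?_
  · rw [card_lt m n hnm, card_ge m n hnm, c4_eq2 m n hn hnm a ha t ht htb, neg_one_mul,
      Nat.cast_sub hnm.le] at h
    exact h
  · intro ρ hρ
    refine inner_head (fun x => Hfun m n a (ρ ^ 2) x)
      ((Hfun_meas m n a).comp (by fun_prop : Measurable fun x : ℝ => (ρ ^ 2, x)))
      (fun x => Hfun_le _ _ _ _ _) _ _ (by positivity) fun r hr => ?_
    rw [Hfun_sq m n hn hnm a ha t ht htb ρ r hρ hr]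
    congr 1
    rw [eq_iff_iff, ← div_eq_inv_mul, lt_div_iff₀ ht, mul_comm]

lemma part3 (m n : ℕ) (a : ℝ) (j : Fin m) :
    ∫ ω, Gfun m n a ω * ω j ∂(Measure.pi fun _ : Fin m => gaussianReal 0 1) = 0 := by
  have : (gaussianReal 0 1).IsNegInvariant :=
    ⟨by rw [Measure.neg]; exact (gaussianReal_map_neg).trans (by simp)⟩
  have h := integral_neg_eq_self (fun ω => Gfun m n a ω * ω j)
    (Measure.pi fun _ : Fin m => gaussianReal 0 1)
  have e : ∀ ω : Fin m → ℝ, Gfun m n a (-ω) * (-ω) j = -(Gfun m n a ω * ω j) := by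
    intro ω
    simp [Gfun]
  simp only [e, integral_neg] at h
  linarith

lemma c4_pos (m n : ℕ) (hn : 1 ≤ n) (hnm : n < m) (a : ℝ) (ha : 0 < a) : 0 < c4 a n m := by
  have hn' : (0 : ℝ) < n := by exact_mod_cast hn
  have hd : (0 : ℝ) < (m : ℝ) - n := by
    have : (n : ℝ) < m := by exact_mod_cast hnm
    linarith
  have hm : (0 : ℝ) < m := by linarith
  have h1 := Real.Gamma_pos_of_pos (half_pos hn')
  have h2 := Real.Gamma_pos_of_pos (half_pos hd)
  have h3 := Real.Gamma_pos_of_pos (half_pos hm)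
  unfold c4
  positivity

lemma prod_single {m : ℕ} (j : Fin m) (k : ℕ) (ω : Fin m → ℝ) :
    ∏ i, He ((Pi.single j k : Fin m → ℕ) i) (ω i) = He k (ω j) := by
  rw [Finset.prod_eq_single j]
  · simp
  · intro i _ hi
    simp [hi, He]
  · simp

/-- The second-order Hermite coefficients of the Fisher–Snedecor
indicator `G` (note `ωⱼ² − 1 = He₂(ωⱼ)`) equal `2c₄(a,n,m)/n` for `1 ≤ j ≤ n` and
`−2c₄(a,n,m)/(m−n)` for `n+1 ≤ j ≤ m`; in particular `G` has Hermite rank 2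
(all coefficients with `|v| = 1` vanish, and some coefficient with `|v| = 2` is
nonzero). -/
theorem stmt10 (m n : ℕ) (hn : 1 ≤ n) (hnm : n < m) (a : ℝ) (ha : 0 < a) :
    (∀ j : Fin m, (j : ℕ) < n →
      ∫ ω, Gfun m n a ω * (ω j ^ 2 - 1) ∂(stdGaussian m) = 2 * c4 a n m / (n : ℝ)) ∧
    (∀ j : Fin m, n ≤ (j : ℕ) →
      ∫ ω, Gfun m n a ω * (ω j ^ 2 - 1) ∂(stdGaussian m)
        = -(2 * c4 a n m / ((m : ℝ) - (n : ℝ)))) ∧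
    (∀ v : Fin m → ℕ, ∑ j, v j = 1 →
      ∫ ω, Gfun m n a ω * ∏ j, He (v j) (ω j) ∂(stdGaussian m) = 0) ∧
    (∃ v : Fin m → ℕ, ∑ j, v j = 2 ∧
      ∫ ω, Gfun m n a ω * ∏ j, He (v j) (ω j) ∂(stdGaussian m) ≠ 0) := by
  refine ⟨part1 m n hn hnm a ha, part2 m n hn hnm a ha, ?_, ?_⟩
  · intro v hv
    obtain ⟨j, hj⟩ : ∃ j, v j ≠ 0 := by
      by_contra! h
      simp [h] at hv
    have hsum := Finset.add_sum_erase Finset.univ v (Finset.mem_univ j)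
    have hz : ∑ i ∈ Finset.univ.erase j, v i = 0 := by omega
    have hv' : v = Pi.single j 1 := by
      ext i
      by_cases hij : i = j
      · subst hij; simp; omega
      · rw [Finset.sum_eq_zero_iff] at hz
        simp [hij, hz i (by simp [hij])]
    subst hv'
    simp only [prod_single, He]
    exact part3 m n a j
  · refine ⟨Pi.single ⟨0, by omega⟩ 2, by simp, ?_⟩
    simp only [prod_single]
    have e : ∀ x : ℝ, He 2 x = x ^ 2 - 1 := by
      intro x
      simp [He]; ring
    simp only [e]
    have h := part1 m n hn hnm a ha ⟨0, by omega⟩ hn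
    unfold _root_.stdGaussian
    rw [h]
    have := c4_pos m n hn hnm a ha
    have hn' : (0 : ℝ) < n := by exact_mod_cast hn
    positivity
end

section
/- Let d ≥ 1. For j = 1, …, m, let α_j > 0, let L_j be slowly varying at infinity, and let B_j : [0,∞) → (0,1] be continuous with B_j(0) = 1 and B_j(z) = z^{−α_j} L_j(z) for z > 0. Let κ ≥ 1 and let (k_{1,κ}, …, k_{m,κ}) be nonnegative integers with ∑_{j=1}^m k_{j,κ} = κ, s := ∑_{j=1}^m α_j k_{j,κ} < d, and ∑_{j=1}^m α_j k_{j,κ} < (κ+1) · min_{1≤j≤m} α_j. Let D > 0 and let ψ : [0,D] → [0,∞) be a measurable function such that ψ(z) ≤ C_0 z^{d−1} for all z ∈ [0,D] and some constant C_0 > 0. Then for every tuple (k̃_1, …, k̃_m) of nonnegative integers with ∑_{j=1}^m k̃_j = κ + 1, one has ∫_0^D ∏_{j=1}^m B_j(rz)^{k̃_j} ψ(z) dz = o(∏_{j=1}^m B_j(r)^{k_{j,κ}}) as r → ∞; that is, the ratio of the left-hand side to ∏_{j=1}^m B_j(r)^{k_{j,κ}} tends to 0 as r → ∞. -/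
open Finset Filter

/-- A measurable function `L : (0,∞) → (0,∞)` is slowly varying at infinity if
`L(λz)/L(z) → 1` as `z → ∞` for every `λ > 0`. -/
def SlowlyVarying (L : ℝ → ℝ) : Prop :=
  Measurable L ∧ (∀ z : ℝ, 0 < z → 0 < L z) ∧
    ∀ lam : ℝ, 0 < lam → Tendsto (fun z => L (lam * z) / L z) atTop (nhds 1)

lemma aux_bdd (f : ℝ → ℝ) (X : ℝ) (hX : 0 < X) (hc : ContinuousOn f (Set.Ici X))
    (h2 : ∀ z, X ≤ z → f (2 * z) ≤ f z) : ∃ C : ℝ, 0 < C ∧ ∀ z, X ≤ z → f z ≤ C := by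
  have hcomp : IsCompact (Set.Icc X (2 * X)) := isCompact_Icc
  obtain ⟨M, hM⟩ := hcomp.bddAbove_image (hc.mono (fun x hx => hx.1))
  have hM' : ∀ z, X ≤ z → z ≤ 2 * X → f z ≤ M := fun z h1 h3 =>
    hM ⟨z, ⟨h1, h3⟩, rfl⟩
  have key : ∀ n : ℕ, ∀ z, X ≤ z → z ≤ 2 ^ (n + 1) * X → f z ≤ M := by
    intro n
    induction n with
    | zero => intro z h1 h3; exact hM' z h1 (by simpa using h3)
    | succ n ih =>
      intro z h1 h3
      by_cases hz : z ≤ 2 * X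
      · exact hM' z h1 hz
      · push Not at hz
        have e : 2 * (z / 2) = z := by ring
        have h4 := h2 (z / 2) (by linarith)
        rw [e] at h4
        refine h4.trans (ih _ (by linarith) ?_)
        rw [pow_succ] at h3
        linarith
  refine ⟨max M 1, by positivity, fun z hz => le_max_of_le_left ?_⟩
  obtain ⟨n, hn⟩ := pow_unbounded_of_one_lt (z / X) (one_lt_two : (1 : ℝ) < 2)
  apply key n z hz
  rw [div_lt_iff₀ hX] at hn
  rw [pow_succ]
  nlinarith

lemma aux_bdd2 (f : ℝ → ℝ) (hpos : ∀ z, 0 < z → 0 < f z) (hc : ContinuousOn f (Set.Ioi 0))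
    (l : ℝ) (hl : l < 1) (h : Tendsto (fun z => f (2 * z) / f z) atTop (nhds l)) :
    ∃ C X : ℝ, 0 < C ∧ 0 < X ∧ ∀ z, X ≤ z → f z ≤ C := by
  obtain ⟨X, hX⟩ := eventually_atTop.1 ((h.eventually_lt_const hl).and (eventually_gt_atTop 0))
  have hX0 : 0 < X := (hX X le_rfl).2
  obtain ⟨C, hC, hb⟩ := aux_bdd f X hX0 (hc.mono (fun x hx => lt_of_lt_of_le hX0 hx)) (by
    intro z hz
    have h1 := (hX z hz).1
    rw [div_lt_one (hpos z (hX z hz).2)] at h1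
    exact h1.le)
  exact ⟨C, X, hC, hX0, hb⟩

lemma aux_ratio (α : ℝ) (L B : ℝ → ℝ) (hL : SlowlyVarying L)
    (hBeq : ∀ z : ℝ, 0 < z → B z = z ^ (-α) * L z) (β : ℝ) :
    Tendsto (fun z => (B (2 * z) * (2 * z) ^ β) / (B z * z ^ β)) atTop
      (nhds ((2 : ℝ) ^ (β - α))) := by
  have h := (hL.2.2 2 two_pos).const_mul ((2 : ℝ) ^ (β - α))
  rw [mul_one] at h
  refine h.congr' ?_
  filter_upwards [eventually_gt_atTop 0] with z hz
  have hLz := (hL.2.1 z hz).ne'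
  have e1 : (0 : ℝ) < z ^ (-α) := Real.rpow_pos_of_pos hz _
  have e2 : (0 : ℝ) < z ^ β := Real.rpow_pos_of_pos hz _
  rw [hBeq z hz, hBeq (2 * z) (by positivity), Real.mul_rpow two_pos.le hz.le,
    Real.mul_rpow two_pos.le hz.le, sub_eq_add_neg, Real.rpow_add two_pos]
  field_simp

lemma aux_cont (B : ℝ → ℝ) (hBcont : ContinuousOn B (Set.Ici 0)) (β : ℝ) :
    ContinuousOn (fun z => B z * z ^ β) (Set.Ioi 0) :=
  (hBcont.mono Set.Ioi_subset_Ici_self).mul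
    (fun z hz => (Real.continuousAt_rpow_const z β (Or.inl (ne_of_gt hz))).continuousWithinAt)

lemma aux_upper (α : ℝ) (L B : ℝ → ℝ) (hL : SlowlyVarying L)
    (hBcont : ContinuousOn B (Set.Ici 0))
    (hBmem : ∀ z : ℝ, 0 ≤ z → B z ∈ Set.Ioc (0 : ℝ) 1)
    (hBeq : ∀ z : ℝ, 0 < z → B z = z ^ (-α) * L z) (β : ℝ) (hβ0 : 0 ≤ β) (hβ : β < α) :
    ∃ C : ℝ, 0 < C ∧ ∀ z, 0 < z → B z ≤ C * z ^ (-β) := by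
  obtain ⟨C, X, hC, hX, hb⟩ := aux_bdd2 (fun z => B z * z ^ β)
    (fun z hz => mul_pos (hBmem z hz.le).1 (Real.rpow_pos_of_pos hz _))
    (aux_cont B hBcont β) _
    (Real.rpow_lt_one_of_one_lt_of_neg one_lt_two (by linarith)) (aux_ratio α L B hL hBeq β)
  refine ⟨max C (X ^ β), lt_max_of_lt_left hC, fun z hz => ?_⟩
  rw [Real.rpow_neg hz.le, ← div_eq_mul_inv, le_div_iff₀ (Real.rpow_pos_of_pos hz _)]
  rcases le_total X z with h | h
  · exact le_max_of_le_left (hb z h)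
  · refine le_max_of_le_right ?_
    calc B z * z ^ β ≤ 1 * z ^ β := by
          gcongr
          exact (hBmem z hz.le).2
      _ ≤ X ^ β := by rw [one_mul]; exact Real.rpow_le_rpow hz.le h hβ0

lemma aux_lower (α : ℝ) (L B : ℝ → ℝ) (hL : SlowlyVarying L)
    (hBcont : ContinuousOn B (Set.Ici 0))
    (hBmem : ∀ z : ℝ, 0 ≤ z → B z ∈ Set.Ioc (0 : ℝ) 1)
    (hBeq : ∀ z : ℝ, 0 < z → B z = z ^ (-α) * L z) (γ : ℝ) (hγ : α < γ) :
    ∃ c : ℝ, 0 < c ∧ ∀ᶠ z in atTop, c * z ^ (-γ) ≤ B z := by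
  have hp : ∀ z, 0 < z → 0 < B z * z ^ γ :=
    fun z hz => mul_pos (hBmem z hz.le).1 (Real.rpow_pos_of_pos hz _)
  obtain ⟨C, X, hC, hX, hb⟩ := aux_bdd2 (fun z => (B z * z ^ γ)⁻¹)
    (fun z hz => inv_pos.2 (hp z hz))
    ((aux_cont B hBcont γ).inv₀ (fun z hz => (hp z hz).ne')) ((2 : ℝ) ^ (γ - α))⁻¹
    (inv_lt_one_of_one_lt₀ (Real.one_lt_rpow one_lt_two (by linarith))) (by
      refine ((aux_ratio α L B hL hBeq γ).inv₀ (by positivity)).congr (fun z => ?_)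
      rw [inv_div_inv, inv_div])
  refine ⟨C⁻¹, inv_pos.2 hC, ?_⟩
  filter_upwards [eventually_ge_atTop X] with z hz
  have hz0 : 0 < z := hX.trans_le hz
  have := hb z hz
  rw [Real.rpow_neg hz0.le, ← div_eq_mul_inv, div_le_iff₀ (Real.rpow_pos_of_pos hz0 _)]
  exact inv_le_of_inv_le₀ (hp z hz0) this

/-- For every tuple `k̃` at level `κ+1`,
`∫₀^D ∏ⱼ Bⱼ(rz)^{k̃ⱼ} ψ(z) dz = o(∏ⱼ Bⱼ(r)^{k_{j,κ}})` as `r → ∞`. -/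
theorem stmt13 (d m : ℕ) (hd : 1 ≤ d) (hm : 1 ≤ m)
    (α : Fin m → ℝ) (hα : ∀ j, 0 < α j)
    (L : Fin m → ℝ → ℝ) (hL : ∀ j, SlowlyVarying (L j))
    (B : Fin m → ℝ → ℝ)
    (hBcont : ∀ j, ContinuousOn (B j) (Set.Ici 0))
    (hBmem : ∀ j, ∀ z : ℝ, 0 ≤ z → B j z ∈ Set.Ioc (0 : ℝ) 1)
    (hB0 : ∀ j, B j 0 = 1)
    (hBeq : ∀ j, ∀ z : ℝ, 0 < z → B j z = z ^ (-(α j)) * L j z)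
    (κ : ℕ) (hκ : 1 ≤ κ) (k₀ : Fin m → ℕ) (hsum₀ : ∑ j, k₀ j = κ)
    (hsd : ∑ j, α j * (k₀ j : ℝ) < (d : ℝ))
    (hmin : ∑ j, α j * (k₀ j : ℝ) < ((κ : ℝ) + 1) * ⨅ j, α j)
    (D : ℝ) (hD : 0 < D) (ψ : ℝ → ℝ) (hψm : Measurable ψ)
    (hψ0 : ∀ z ∈ Set.Icc (0 : ℝ) D, 0 ≤ ψ z)
    (C₀ : ℝ) (hC₀ : 0 < C₀)
    (hψle : ∀ z ∈ Set.Icc (0 : ℝ) D, ψ z ≤ C₀ * z ^ (d - 1))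
    (kt : Fin m → ℕ) (hkt : ∑ j, kt j = κ + 1) :
    Tendsto
      (fun r => (∫ z in (0 : ℝ)..D, (∏ j, B j (r * z) ^ kt j) * ψ z) /
        ∏ j, B j r ^ k₀ j)
      atTop (nhds 0) := by
  have : Nonempty (Fin m) := ⟨⟨0, hm⟩⟩
  set s := ∑ j, α j * (k₀ j : ℝ) with hs
  have hs0 : 0 ≤ s := Finset.sum_nonneg fun j _ => mul_nonneg (hα j).le (Nat.cast_nonneg _)
  obtain ⟨t, hst, ht⟩ := exists_between (lt_min hsd hmin)
  have htd : t < d := ht.trans_le (min_le_left _ _)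
  have htm := ht.trans_le (min_le_right _ _)
  have hκ1 : (0 : ℝ) < (κ : ℝ) + 1 := by positivity
  have hκ0 : (0 : ℝ) < (κ : ℝ) := by exact_mod_cast hκ
  set β := t / ((κ : ℝ) + 1) with hβd
  have hβ0 : 0 ≤ β := div_nonneg (by linarith) hκ1.le
  have hβ : ∀ j, β < α j := by
    intro j
    have h1 : β < ⨅ j, α j := by rw [hβd, div_lt_iff₀ hκ1]; linarith
    exact h1.trans_le (ciInf_le (Set.finite_range α).bddBelow j)
  set η := (t - s) / (2 * κ) with hη
  have hη0 : 0 < η := by apply div_pos <;> linarith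
  have hηs : s + κ * η = (s + t) / 2 := by rw [hη]; field_simp; ring
  choose C hC hCB using fun j => aux_upper (α j) (L j) (B j) (hL j) (hBcont j) (hBmem j)
    (hBeq j) β hβ0 (hβ j)
  choose c hc hcB using fun j => aux_lower (α j) (L j) (B j) (hL j) (hBcont j) (hBmem j)
    (hBeq j) (α j + η) (by linarith)
  set K := ∏ j, C j ^ kt j with hK
  set k := ∏ j, c j ^ k₀ j with hk
  have hK0 : 0 < K := Finset.prod_pos fun j _ => pow_pos (hC j) _
  have hk0 : 0 < k := Finset.prod_pos fun j _ => pow_pos (hc j) _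
  have hup : ∀ y, 0 < y → ∏ j, B j y ^ kt j ≤ K * y ^ (-t) := by
    intro y hy
    calc ∏ j, B j y ^ kt j ≤ ∏ j, (C j * y ^ (-β)) ^ kt j := by
          refine Finset.prod_le_prod (fun j _ => pow_nonneg (hBmem j y hy.le).1.le _)
            (fun j _ => ?_)
          exact pow_le_pow_left₀ (hBmem j y hy.le).1.le (hCB j y hy) _
      _ = K * y ^ (-t) := by
          simp_rw [mul_pow]
          rw [Finset.prod_mul_distrib, Finset.prod_pow_eq_pow_sum, hkt, ← Real.rpow_natCast,
            ← Real.rpow_mul hy.le]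
          congr 2
          rw [hβd]; push_cast; field_simp
  have hlow : ∀ᶠ r in atTop, k * r ^ (-((s + t) / 2)) ≤ ∏ j, B j r ^ k₀ j := by
    filter_upwards [eventually_all.2 hcB, eventually_gt_atTop 0] with r hr hr0
    calc k * r ^ (-((s + t) / 2)) = ∏ j, (c j * r ^ (-(α j + η))) ^ k₀ j := by
          simp_rw [mul_pow]
          rw [Finset.prod_mul_distrib]
          congr 1
          simp_rw [← Real.rpow_natCast, ← Real.rpow_mul hr0.le]
          rw [← Real.rpow_sum_of_pos hr0]
          congr 1
          rw [← hηs, hs, ← hsum₀]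
          push_cast
          rw [Finset.sum_mul, ← Finset.sum_add_distrib, ← Finset.sum_neg_distrib]
          exact Finset.sum_congr rfl fun j _ => by ring
      _ ≤ _ := by
          refine Finset.prod_le_prod (fun j _ => ?_) (fun j _ => ?_)
          · exact pow_nonneg (mul_nonneg (hc j).le (Real.rpow_nonneg hr0.le _)) _
          · exact pow_le_pow_left₀ (mul_nonneg (hc j).le (Real.rpow_nonneg hr0.le _)) (hr j) _
  set I := ∫ z in (0 : ℝ)..D, z ^ ((d : ℝ) - 1 - t) with hI
  have hint : ∀ r, 0 < r → ‖∫ z in (0 : ℝ)..D, (∏ j, B j (r * z) ^ kt j) * ψ z‖ ≤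
      K * C₀ * r ^ (-t) * I := by
    intro r hr
    rw [hI, ← intervalIntegral.integral_const_mul]
    refine intervalIntegral.norm_integral_le_of_norm_le hD.le (Eventually.of_forall ?_)
      ((intervalIntegral.intervalIntegrable_rpow' (by linarith)).const_mul _)
    intro z hz
    have hz0 : 0 < z := hz.1
    have hzm : z ∈ Set.Icc (0 : ℝ) D := ⟨hz.1.le, hz.2⟩
    have hrz : 0 < r * z := mul_pos hr hz0
    have hP : 0 ≤ ∏ j, B j (r * z) ^ kt j :=
      Finset.prod_nonneg fun j _ => pow_nonneg (hBmem j _ hrz.le).1.le _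
    rw [Real.norm_of_nonneg (mul_nonneg hP (hψ0 z hzm))]
    calc _ ≤ (K * (r * z) ^ (-t)) * (C₀ * z ^ (d - 1)) :=
          mul_le_mul (hup _ hrz) (hψle z hzm) (hψ0 z hzm)
            (mul_nonneg hK0.le (Real.rpow_nonneg hrz.le _))
      _ = _ := by
          have e : (z : ℝ) ^ (d - 1) = z ^ ((d : ℝ) - 1) := by
            rw [← Real.rpow_natCast, Nat.cast_sub hd, Nat.cast_one]
          rw [e, Real.mul_rpow hr.le hz0.le, sub_eq_add_neg ((d : ℝ) - 1) t,
            Real.rpow_add hz0]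
          ring
  have hlim : Tendsto (fun r : ℝ => K * C₀ * I / k * r ^ (-((t - s) / 2))) atTop (nhds 0) := by
    have := (tendsto_rpow_neg_atTop (y := (t - s) / 2) (by linarith)).const_mul (K * C₀ * I / k)
    rwa [mul_zero] at this
  refine squeeze_zero_norm' ?_ hlim
  filter_upwards [hlow, eventually_gt_atTop 0] with r hr hr0
  have hq : 0 < k * r ^ (-((s + t) / 2)) := mul_pos hk0 (Real.rpow_pos_of_pos hr0 _)
  rw [norm_div, Real.norm_of_nonneg (hq.le.trans hr)]
  calc _ ≤ (K * C₀ * r ^ (-t) * I) / (k * r ^ (-((s + t) / 2))) :=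
        div_le_div₀ ((norm_nonneg _).trans (hint r hr0)) (hint r hr0) hq hr
    _ = _ := by
        have e : -t = -((t - s) / 2) + -((s + t) / 2) := by ring
        have := Real.rpow_pos_of_pos hr0 (-((s + t) / 2))
        rw [e, Real.rpow_add hr0]
        field_simp
end

section
/- Let d ≥ 1. For j = 1, …, m, let α_j > 0, let L_j be slowly varying at infinity, and let B_j : [0,∞) → (0,1] be continuous with B_j(0) = 1 and B_j(z) = z^{−α_j} L_j(z) for z > 0. Let Δ ⊂ ℝ^d be a Jordan-measurable convex bounded set with |Δ| > 0, and Δ(r) = {rx : x ∈ Δ} for r > 0. Let (k_1, …, k_m) be nonnegative integers, not all zero, with s := ∑_{j=1}^m α_j k_j < d. Then lim_{r→∞} [∫_{Δ(r)} ∫_{Δ(r)} ∏_{j=1}^m B_j(‖x − y‖)^{k_j} dx dy] / [r^{2d−s} ∏_{j=1}^m L_j(r)^{k_j}] = ∫_Δ ∫_Δ ‖u − v‖^{−s} du dv, and the right-hand side is finite and positive. -/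
open MeasureTheory Finset Filter

/-- The homothetic image `Δ(r) = {r x : x ∈ Δ}`. -/
def homothety {d : ℕ} (Δ : Set (EuclideanSpace ℝ (Fin d))) (r : ℝ) :
    Set (EuclideanSpace ℝ (Fin d)) :=
  (fun x => r • x) '' Δ


lemma potter_add (f : ℝ → ℝ) (hf : Continuous f)
    (h : ∀ u : ℝ, Tendsto (fun x => f (x + u) - f x) atTop (nhds 0)) (ε : ℝ) (hε : 0 < ε) :
    ∃ X : ℝ, ∀ x, X ≤ x → ∀ u, 0 ≤ u → |f (x + u) - f x| ≤ ε * u + 2 := by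
  let E : ℕ → Set ℝ := fun n => {u | ∀ x : ℝ, (n : ℝ) ≤ x → |f (x + u) - f x| ≤ 1}
  have hc : ∀ n, IsClosed (E n) := by
    intro n
    have : E n = ⋂ x : ℝ, ⋂ _ : (n : ℝ) ≤ x, {u | |f (x + u) - f x| ≤ 1} := by
      ext u; simp [E]
    rw [this]
    refine isClosed_iInter fun x => isClosed_iInter fun _ => ?_
    exact isClosed_le (by fun_prop) continuous_const
  have hU : ⋃ n, E n = Set.univ := by
    refine Set.eq_univ_of_forall fun u => ?_
    have h1 := (h u).eventually (Metric.closedBall_mem_nhds 0 one_pos)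
    obtain ⟨Y, hY⟩ := eventually_atTop.1 h1
    obtain ⟨n, hn⟩ := exists_nat_ge Y
    refine Set.mem_iUnion.2 ⟨n, fun x hx => ?_⟩
    simpa using hY x (hn.trans hx)
  obtain ⟨n, c, hcI⟩ := nonempty_interior_of_iUnion_of_closed hc hU
  obtain ⟨e, he, hball⟩ := Metric.isOpen_iff.1 isOpen_interior c hcI
  have hsub : Metric.ball c e ⊆ E n := hball.trans interior_subset
  set δ := e / 2 with hδ
  have hδ0 : 0 < δ := by positivity
  have hloc : ∀ x : ℝ, n + c ≤ x → ∀ u, 0 ≤ u → u ≤ δ → |f (x + u) - f x| ≤ 2 := by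
    intro x hx u hu0 hu
    have a1 := hsub (show c + u ∈ Metric.ball c e by
      simp [Real.dist_eq, abs_of_nonneg hu0]; linarith) (x - c) (by linarith)
    have a2 := hsub (Metric.mem_ball_self he) (x - c) (by linarith)
    rw [show x - c + (c + u) = x + u by ring] at a1
    rw [show x - c + c = x by ring] at a2
    rw [abs_le] at *
    constructor <;> linarith
  have h1 := (h δ).eventually (Metric.closedBall_mem_nhds 0 (mul_pos hε hδ0))
  obtain ⟨Y, hY⟩ := eventually_atTop.1 h1
  refine ⟨max Y (n + c), fun x hx u hu => ?_⟩
  have hstep : ∀ N : ℕ, |f (x + N * δ) - f x| ≤ ε * (N * δ) := by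
    intro N
    induction N with
    | zero => simp
    | succ N ih =>
      have h0 : (0:ℝ) ≤ N * δ := by positivity
      have := hY (x + N * δ) (by linarith [le_max_left Y (n + c)])
      simp only [Metric.mem_closedBall, Real.dist_eq, sub_zero] at this
      rw [show x + N * δ + δ = x + (N + 1 : ℕ) * δ by push_cast; ring] at this
      push_cast at *
      rw [abs_le] at *
      constructor <;> nlinarith
  set N := ⌊u / δ⌋₊
  have n1 : N * δ ≤ u := by
    rw [← le_div_iff₀ hδ0]; exact Nat.floor_le (by positivity)
  have n2 : u ≤ (N + 1) * δ := by
    rw [← div_le_iff₀ hδ0]; exact (Nat.lt_floor_add_one _).le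
  have h0 : (0:ℝ) ≤ N * δ := by positivity
  have b1 := hstep N
  have b2 := hloc (x + N * δ) (by linarith [le_max_right Y (n + c)]) (u - N * δ) (by linarith)
    (by linarith)
  rw [show x + N * δ + (u - N * δ) = x + u by ring] at b2
  have b3 : ε * (N * δ) ≤ ε * u := by gcongr
  rw [abs_le] at *
  constructor <;> linarith

lemma potter_mul (G : ℝ → ℝ) (s : ℝ) (hG : ContinuousOn G (Set.Ici 0))
    (hm : ∀ z : ℝ, 0 ≤ z → G z ∈ Set.Ioc (0 : ℝ) 1)
    (hlim : ∀ t : ℝ, 0 < t → Tendsto (fun r => G (r * t) / G r) atTop (nhds (t ^ (-s))))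
    (hs : 0 ≤ s) (δ : ℝ) (hδ : 0 < δ) (D : ℝ) (hD : 1 ≤ D) :
    ∃ C X : ℝ, 0 < X ∧ 0 ≤ C ∧ ∀ r, X ≤ r → ∀ t, 0 < t → t ≤ D →
      G (r * t) / G r ≤ C * t ^ (-(s + δ)) := by
  have hpos : ∀ z, 0 ≤ z → 0 < G z := fun z hz => (hm z hz).1
  let f : ℝ → ℝ := fun x => Real.log (G (Real.exp x)) + s * x
  have hfc : Continuous f := by
    refine Continuous.add (Continuous.log ?_ fun x => (hpos _ (Real.exp_pos x).le).ne')
      (by fun_prop)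
    exact hG.comp_continuous Real.continuous_exp fun x => (Real.exp_pos x).le
  have hfl : ∀ u : ℝ, Tendsto (fun x => f (x + u) - f x) atTop (nhds 0) := by
    intro u
    have h1 := ((hlim _ (Real.exp_pos u)).comp Real.tendsto_exp_atTop).log
      (Real.rpow_pos_of_pos (Real.exp_pos u) _).ne'
    have h2 := h1.add_const (s * u)
    rw [Real.log_rpow (Real.exp_pos u), Real.log_exp, neg_mul, neg_add_cancel] at h2
    refine h2.congr fun x => ?_
    simp only [Function.comp, f]
    rw [Real.log_div (hpos _ (by positivity)).ne' (hpos _ (by positivity)).ne', Real.exp_add]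
    ring
  obtain ⟨X₀, hX₀⟩ := potter_add f hfc hfl δ hδ
  have hfG : ∀ r : ℝ, 0 < r → Real.log (G r) = f (Real.log r) - s * Real.log r := by
    intro r hr; simp [f, Real.exp_log hr]
  set X := Real.exp X₀
  have hX : 0 < X := Real.exp_pos _
  have hlX : Real.log X = X₀ := Real.log_exp _
  refine ⟨Real.exp (2 + 2 * δ * Real.log D - Real.log (G X)), X, hX, by positivity, ?_⟩
  intro r hr t ht htD
  have hr0 : 0 < r := hX.trans_le hr
  have hrt : 0 < r * t := by positivity
  have key : Real.log (G (r * t)) - Real.log (G r) ≤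
      2 + 2 * δ * Real.log D - Real.log (G X) - (s + δ) * Real.log t := by
    have hlr : X₀ ≤ Real.log r := by rw [← hlX]; exact Real.log_le_log hX hr
    have hlD : 0 ≤ Real.log D := Real.log_nonneg hD
    have hGX : Real.log (G X) ≤ 0 := Real.log_nonpos (hpos _ hX.le).le (hm _ hX.le).2
    have hlrt : Real.log (r * t) = Real.log r + Real.log t := Real.log_mul hr0.ne' ht.ne'
    have htD' : Real.log t ≤ Real.log D := Real.log_le_log ht htD
    have hδD : 0 ≤ δ * Real.log D := by positivity
    rcases le_total 0 (Real.log t) with h0 | h0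
    · have := (abs_le.1 (hX₀ _ hlr _ h0)).2
      rw [hfG _ hrt, hfG _ hr0, hlrt]
      nlinarith
    · rcases le_total X (r * t) with h1 | h1
      · have h2 : X₀ ≤ Real.log r + Real.log t := by
          rw [← hlX, ← hlrt]; exact Real.log_le_log hX h1
        have := (abs_le.1 (hX₀ _ h2 (-Real.log t) (by linarith))).1
        rw [add_neg_cancel_right] at this
        rw [hfG _ hrt, hfG _ hr0, hlrt]
        nlinarith
      · have h2 : Real.log r + Real.log t ≤ X₀ := by
          rw [← hlX, ← hlrt]; exact Real.log_le_log hrt h1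
        have h3 : Real.log (G (r * t)) ≤ 0 := Real.log_nonpos (hpos _ hrt.le).le (hm _ hrt.le).2
        have := (abs_le.1 (hX₀ _ le_rfl (Real.log r - X₀) (by linarith))).1
        rw [add_sub_cancel] at this
        rw [hfG _ hr0, hfG _ hX, hlX]
        rw [hfG _ hX, hlX] at hGX
        nlinarith
  rw [← Real.log_div (hpos _ hrt.le).ne' (hpos _ hr0.le).ne'] at key
  rw [Real.rpow_def_of_pos ht, ← Real.exp_add]
  rw [Real.log_le_iff_le_exp (div_pos (hpos _ hrt.le) (hpos _ hr0.le))] at key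
  refine key.trans (Real.exp_le_exp.2 ?_)
  linarith

lemma kern_bound (d : ℕ) (hd : 1 ≤ d) (Δ : Set (EuclideanSpace ℝ (Fin d)))
    (hΔm : MeasurableSet Δ) (D : ℝ)
    (hD : ∀ u ∈ Δ, ∀ v ∈ Δ, ‖u - v‖ < D) (p : ℝ) (hp : p < d) :
    ∃ I : ℝ, ∀ u ∈ Δ, IntegrableOn (fun v => ‖u - v‖ ^ (-p)) Δ ∧
      ∫ v in Δ, ‖u - v‖ ^ (-p) ≤ I := by
  have hfr : Module.finrank ℝ (EuclideanSpace ℝ (Fin d)) = d := by simp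
  have hmeas : Measurable (fun w : EuclideanSpace ℝ (Fin d) => ‖w‖ ^ (-p)) := by fun_prop
  have h0 : IntegrableOn (fun w : EuclideanSpace ℝ (Fin d) => ‖w‖ ^ (-p)) (Metric.ball 0 D) := by
    refine integrableOn_ball_of_norm_le_rpow (C := 1) (α := p) (by rw [hfr]; exact hd)
      (by rw [hfr]; exact hp) ?_ hmeas.aestronglyMeasurable
    refine ae_of_all _ fun x => ?_
    rw [Real.norm_of_nonneg (by positivity), one_mul]
  set g : EuclideanSpace ℝ (Fin d) → ℝ :=
    (Metric.ball 0 D).indicator (fun w => ‖w‖ ^ (-p)) with hg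
  have hgi : Integrable g := (integrable_indicator_iff measurableSet_ball).2 h0
  have hg0 : ∀ w, 0 ≤ g w := fun w => Set.indicator_nonneg (fun _ _ => by positivity) _
  refine ⟨∫ w, g w, fun u hu => ?_⟩
  have heq : Set.EqOn (fun v => g (u - v)) (fun v => ‖u - v‖ ^ (-p)) Δ := by
    intro v hv
    simp only [hg]
    rw [Set.indicator_of_mem]
    simpa using hD u hu v hv
  have hi : Integrable (fun v => g (u - v)) := hgi.comp_sub_left u
  refine ⟨hi.integrableOn.congr_fun heq hΔm, ?_⟩
  rw [← setIntegral_congr_fun hΔm heq, ← integral_sub_left_eq_self g volume u]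
  exact setIntegral_le_integral hi (ae_of_all _ fun v => hg0 _)

lemma main_conv (d : ℕ) (hd : 1 ≤ d) (G : ℝ → ℝ) (s : ℝ) (hG : ContinuousOn G (Set.Ici 0))
    (hm : ∀ z : ℝ, 0 ≤ z → G z ∈ Set.Ioc (0 : ℝ) 1)
    (hlim : ∀ t : ℝ, 0 < t → Tendsto (fun r => G (r * t) / G r) atTop (nhds (t ^ (-s))))
    (hs : 0 ≤ s) (hsd : s < d)
    (Δ : Set (EuclideanSpace ℝ (Fin d)))
    (hΔm : MeasurableSet Δ) (hΔf : volume Δ < ⊤) (D : ℝ) (hD1 : 1 ≤ D)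
    (hD : ∀ u ∈ Δ, ∀ v ∈ Δ, ‖u - v‖ < D) :
    Tendsto (fun r : ℝ => ∫ u in Δ, ∫ v in Δ, G (r * ‖u - v‖) / G r) atTop
      (nhds (∫ u in Δ, ∫ v in Δ, ‖u - v‖ ^ (-s))) := by
  have : Fact (volume Δ < ⊤) := ⟨hΔf⟩
  have : Nonempty (Fin d) := ⟨⟨0, hd⟩⟩
  have : Nontrivial (EuclideanSpace ℝ (Fin d)) := by
    apply Module.nontrivial_of_finrank_pos (R := ℝ)
    simp; omega
  set δ := (d - s) / 2 with hδ
  have hδ0 : 0 < δ := by rw [hδ]; linarith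
  obtain ⟨C, X, hX, hC, hb⟩ := potter_mul G s hG hm hlim hs δ hδ0 D hD1
  obtain ⟨I, hI⟩ := kern_bound d hd Δ hΔm D hD (s + δ) (by rw [hδ]; linarith)
  have hcont : ∀ r : ℝ, 0 ≤ r → Continuous
      (fun q : EuclideanSpace ℝ (Fin d) × EuclideanSpace ℝ (Fin d) =>
        G (r * ‖q.1 - q.2‖) / G r) := by
    intro r hr
    refine Continuous.div_const ?_ _
    exact hG.comp_continuous (by fun_prop) fun q =>
      Set.mem_Ici.2 (mul_nonneg hr (norm_nonneg _))
  have hne : ∀ u : EuclideanSpace ℝ (Fin d), ∀ᵐ v ∂(volume.restrict Δ), v ≠ u := by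
    intro u
    refine ae_restrict_of_ae ?_
    exact Measure.ae_ne volume u
  have hbd : ∀ r, X ≤ r → ∀ u ∈ Δ, ∀ᵐ v ∂(volume.restrict Δ),
      ‖G (r * ‖u - v‖) / G r‖ ≤ C * ‖u - v‖ ^ (-(s + δ)) := by
    intro r hr u hu
    filter_upwards [hne u, ae_restrict_mem hΔm] with v hv hvΔ
    have h1 : 0 < ‖u - v‖ := norm_pos_iff.2 (sub_ne_zero.2 hv.symm)
    have hr0 : 0 < r := hX.trans_le hr
    rw [Real.norm_of_nonneg (div_nonneg (hm _ (by positivity)).1.le (hm _ hr0.le).1.le)]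
    exact hb r hr _ h1 (hD u hu v hvΔ).le
  refine tendsto_integral_filter_of_dominated_convergence (fun _ => C * I) ?_ ?_
    (integrable_const _) ?_
  · filter_upwards [eventually_ge_atTop X] with r hr
    have := (hcont r (hX.le.trans hr)).stronglyMeasurable.integral_prod_right'
      (ν := volume.restrict Δ)
    exact this.aestronglyMeasurable
  · filter_upwards [eventually_ge_atTop X] with r hr
    filter_upwards [ae_restrict_mem hΔm] with u hu
    refine (norm_integral_le_of_norm_le ((hI u hu).1.const_mul C) (hbd r hr u hu)).trans ?_
    rw [integral_const_mul]
    exact mul_le_mul_of_nonneg_left (hI u hu).2 hC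
  · filter_upwards [ae_restrict_mem hΔm] with u hu
    refine tendsto_integral_filter_of_dominated_convergence
      (fun v => C * ‖u - v‖ ^ (-(s + δ))) ?_ ?_ ((hI u hu).1.const_mul C) ?_
    · filter_upwards [eventually_ge_atTop X] with r hr
      exact ((hcont r (hX.le.trans hr)).comp (Continuous.prodMk_right u)).aestronglyMeasurable
    · filter_upwards [eventually_ge_atTop X] with r hr
      exact hbd r hr u hu
    · filter_upwards [hne u] with v hv
      exact hlim _ (norm_pos_iff.2 (sub_ne_zero.2 hv.symm))

lemma limit_pos_fin (d : ℕ) (hd : 1 ≤ d) (s : ℝ) (hs : 0 ≤ s) (hsd : s < d)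
    (Δ : Set (EuclideanSpace ℝ (Fin d)))
    (hΔm : MeasurableSet Δ) (hΔf : volume Δ < ⊤) (hΔpos : 0 < volume Δ) (D : ℝ) (hD1 : 1 ≤ D)
    (hD : ∀ u ∈ Δ, ∀ v ∈ Δ, ‖u - v‖ < D) :
    (0 < ∫ u in Δ, ∫ v in Δ, ‖u - v‖ ^ (-s)) ∧
    (∫⁻ u in Δ, ∫⁻ v in Δ, ENNReal.ofReal (‖u - v‖ ^ (-s)) ∂volume ∂volume) < ⊤ := by
  have : Fact (volume Δ < ⊤) := ⟨hΔf⟩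
  have : Nontrivial (EuclideanSpace ℝ (Fin d)) := by
    apply Module.nontrivial_of_finrank_pos (R := ℝ)
    simp; omega
  obtain ⟨I, hI⟩ := kern_bound d hd Δ hΔm D hD s hsd
  have hmeas : StronglyMeasurable
      (fun q : EuclideanSpace ℝ (Fin d) × EuclideanSpace ℝ (Fin d) => ‖q.1 - q.2‖ ^ (-s)) := by
    apply Measurable.stronglyMeasurable
    fun_prop
  have hvol : 0 < volume.real Δ := ENNReal.toReal_pos hΔpos.ne' hΔf.ne
  set c : ℝ := D ^ (-s) * volume.real Δ
  have hc : 0 < c := by positivity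
  have hlow : ∀ u ∈ Δ, c ≤ ∫ v in Δ, ‖u - v‖ ^ (-s) := by
    intro u hu
    have : ∫ v in Δ, D ^ (-s) = c := by simp [c, mul_comm]
    rw [← this]
    refine integral_mono_ae (integrable_const _) (hI u hu).1 ?_
    filter_upwards [ae_restrict_of_ae (Measure.ae_ne volume u), ae_restrict_mem hΔm] with v hv hvΔ
    have h1 : 0 < ‖u - v‖ := norm_pos_iff.2 (sub_ne_zero.2 hv.symm)
    exact Real.rpow_le_rpow_of_nonpos h1 (hD u hu v hvΔ).le (by linarith)
  have hint : IntegrableOn (fun u => ∫ v in Δ, ‖u - v‖ ^ (-s)) Δ := by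
    refine Integrable.mono' (integrable_const I)
      (hmeas.integral_prod_right' (ν := volume.restrict Δ)).aestronglyMeasurable ?_
    filter_upwards [ae_restrict_mem hΔm] with u hu
    rw [Real.norm_of_nonneg (hc.le.trans (hlow u hu))]
    exact (hI u hu).2
  constructor
  · have h1 : ∫ u in Δ, c ≤ ∫ u in Δ, ∫ v in Δ, ‖u - v‖ ^ (-s) :=
      setIntegral_mono_on (integrable_const _) hint hΔm hlow
    refine lt_of_lt_of_le ?_ h1
    simp only [integral_const, smul_eq_mul]
    simp
    positivity
  · have h1 : (∫⁻ u in Δ, ∫⁻ v in Δ, ENNReal.ofReal (‖u - v‖ ^ (-s)) ∂volume ∂volume) ≤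
        ∫⁻ u in Δ, ENNReal.ofReal I := by
      refine setLIntegral_mono' hΔm fun u hu => ?_
      rw [← ofReal_integral_eq_lintegral_ofReal (hI u hu).1 (ae_of_all _ fun v => by positivity)]
      exact ENNReal.ofReal_le_ofReal (hI u hu).2
    refine h1.trans_lt ?_
    rw [setLIntegral_const]
    exact ENNReal.mul_lt_top ENNReal.ofReal_lt_top hΔf

/-- With `s = ∑ⱼ αⱼ kⱼ < d` and the `kⱼ` not all zero,
`[∫_{Δ(r)} ∫_{Δ(r)} ∏ⱼ Bⱼ(‖x−y‖)^{kⱼ} dx dy] / [r^{2d−s} ∏ⱼ Lⱼ(r)^{kⱼ}]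
  → ∫_Δ ∫_Δ ‖u−v‖^{−s} du dv` as `r → ∞`, and the limit is finite and positive. -/
theorem stmt14 (d m : ℕ) (hd : 1 ≤ d) (hm : 1 ≤ m)
    (α : Fin m → ℝ) (hα : ∀ j, 0 < α j)
    (L : Fin m → ℝ → ℝ) (hL : ∀ j, SlowlyVarying (L j))
    (B : Fin m → ℝ → ℝ)
    (hBcont : ∀ j, ContinuousOn (B j) (Set.Ici 0))
    (hBmem : ∀ j, ∀ z : ℝ, 0 ≤ z → B j z ∈ Set.Ioc (0 : ℝ) 1)
    (hB0 : ∀ j, B j 0 = 1)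
    (hBeq : ∀ j, ∀ z : ℝ, 0 < z → B j z = z ^ (-(α j)) * L j z)
    (Δ : Set (EuclideanSpace ℝ (Fin d)))
    (hΔm : MeasurableSet Δ) (hΔb : Bornology.IsBounded Δ) (hΔc : Convex ℝ Δ)
    (hΔj : volume (frontier Δ) = 0) (hΔpos : 0 < volume Δ)
    (k : Fin m → ℕ) (hk : ∃ j, k j ≠ 0)
    (hsd : ∑ j, α j * (k j : ℝ) < (d : ℝ)) :
    Tendsto
      (fun r : ℝ =>
        (∫ x in homothety Δ r, ∫ y in homothety Δ r, ∏ j, B j ‖x - y‖ ^ k j) /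
          (r ^ (2 * (d : ℝ) - ∑ j, α j * (k j : ℝ)) * ∏ j, L j r ^ k j))
      atTop
      (nhds (∫ u in Δ, ∫ v in Δ, ‖u - v‖ ^ (-(∑ j, α j * (k j : ℝ))))) ∧
    (0 < ∫ u in Δ, ∫ v in Δ, ‖u - v‖ ^ (-(∑ j, α j * (k j : ℝ)))) ∧
    (∫⁻ u in Δ, ∫⁻ v in Δ,
        ENNReal.ofReal (‖u - v‖ ^ (-(∑ j, α j * (k j : ℝ)))) ∂volume ∂volume) < ⊤ := by
  set s : ℝ := ∑ j, α j * (k j : ℝ) with hs_def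
  have hs : 0 ≤ s := Finset.sum_nonneg fun j _ => mul_nonneg (hα j).le (Nat.cast_nonneg _)
  obtain ⟨D, hD1, hD⟩ : ∃ D : ℝ, 1 ≤ D ∧ ∀ u ∈ Δ, ∀ v ∈ Δ, ‖u - v‖ < D := by
    obtain ⟨R, hR⟩ := hΔb.exists_norm_le
    refine ⟨max 1 (2 * R + 1), le_max_left _ _, fun u hu v hv => lt_max_of_lt_right ?_⟩
    have := norm_sub_le u v
    linarith [hR u hu, hR v hv]
  have hΔf : volume Δ < ⊤ := hΔb.measure_lt_top
  refine ⟨?_, limit_pos_fin d hd s hs hsd Δ hΔm hΔf hΔpos D hD1 hD⟩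
  set G : ℝ → ℝ := fun z => ∏ j, B j z ^ k j with hG_def
  have hGc : ContinuousOn G (Set.Ici 0) :=
    continuousOn_finsetProd _ fun j _ => (hBcont j).pow _
  have hGm : ∀ z : ℝ, 0 ≤ z → G z ∈ Set.Ioc (0 : ℝ) 1 := fun z hz =>
    ⟨Finset.prod_pos fun j _ => pow_pos (hBmem j z hz).1 _,
      Finset.prod_le_one (fun j _ => (pow_pos (hBmem j z hz).1 _).le)
        fun j _ => pow_le_one₀ (hBmem j z hz).1.le (hBmem j z hz).2⟩
  have hGL : ∀ z : ℝ, 0 < z → G z = z ^ (-s) * ∏ j, L j z ^ k j := by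
    intro z hz
    have h1 : z ^ (-s) = ∏ j, (z ^ (-(α j))) ^ k j := by
      rw [hs_def, ← Finset.sum_neg_distrib, Real.rpow_sum_of_pos hz]
      refine Finset.prod_congr rfl fun j _ => ?_
      rw [← Real.rpow_natCast, ← Real.rpow_mul hz.le, neg_mul]
    rw [h1, ← Finset.prod_mul_distrib]
    refine Finset.prod_congr rfl fun j _ => ?_
    rw [hBeq j z hz, mul_pow]
  have hlim : ∀ t : ℝ, 0 < t → Tendsto (fun r => G (r * t) / G r) atTop (nhds (t ^ (-s))) := by
    intro t ht
    have h1 : Tendsto (fun r => t ^ (-s) * ∏ j, (L j (t * r) / L j r) ^ k j) atTop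
        (nhds (t ^ (-s) * ∏ j : Fin m, (1 : ℝ) ^ k j)) :=
      (tendsto_finsetProd _ fun j _ => ((hL j).2.2 t ht).pow (k j)).const_mul _
    simp only [one_pow, Finset.prod_const_one, mul_one] at h1
    refine h1.congr' ?_
    filter_upwards [eventually_gt_atTop 0] with r hr
    have hLp : 0 < ∏ j, L j r ^ k j := Finset.prod_pos fun j _ => pow_pos ((hL j).2.1 r hr) _
    have hrs : 0 < r ^ (-s) := Real.rpow_pos_of_pos hr _
    rw [hGL _ (mul_pos hr ht), hGL r hr, Real.mul_rpow hr.le ht.le, mul_comm r t]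
    simp only [div_pow, Finset.prod_div_distrib]
    field_simp
  refine (main_conv d hd G s hGc hGm hlim hs hsd Δ hΔm hΔf D hD1 hD).congr' ?_
  filter_upwards [eventually_gt_atTop 0] with r hr
  have hfr : Module.finrank ℝ (EuclideanSpace ℝ (Fin d)) = d := by simp
  have hcv : ∀ F : EuclideanSpace ℝ (Fin d) → ℝ,
      ∫ x in homothety Δ r, F x = r ^ d * ∫ x in Δ, F (r • x) := by
    intro F
    have h1 := Measure.setIntegral_comp_smul_of_pos volume F Δ hr
    rw [hfr, smul_eq_mul] at h1
    rw [h1, ← mul_assoc, mul_inv_cancel₀ (by positivity), one_mul]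
    rfl
  have hden : r ^ (2 * (d : ℝ) - s) * ∏ j, L j r ^ k j = r ^ d * r ^ d * G r := by
    rw [hGL r hr, sub_eq_add_neg, Real.rpow_add hr, two_mul, Real.rpow_add hr, Real.rpow_natCast]
    ring
  rw [hden, hcv]
  simp only [hcv]
  have hnorm : ∀ x y : EuclideanSpace ℝ (Fin d), ‖r • x - r • y‖ = r * ‖x - y‖ := by
    intro x y
    rw [← smul_sub, norm_smul, Real.norm_of_nonneg hr.le]
  simp only [hnorm, integral_const_mul, integral_div]
  have hrd : (0:ℝ) < r ^ d := by positivity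
  have hGr := (hGm r hr.le).1
  simp only [hG_def] at hGr ⊢
  field_simp
end
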